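/- Let β ∈ (−1/2, 1/2) and let g be a measurable function on ℝ with ∫_ℝ |g(ξ)|² |ξ|^{2β} dξ < ∞. For n ∈ ℤ set g_n = χ_{I_n} g with I_n = [−2^{n+1}, −2^n] ∪ [2^n, 2^{n+1}]. Then there is a constant C depending only on β such that Σ_{m∈ℤ} Σ_{k∈ℤ} ∫_{I_m} | Σ_{n : |n−m| ≥ 2} (φ_k^∨ * g_n)(ξ) |² |ξ|^{2β} dξ ≤ C ∫_ℝ |g(ξ)|² |ξ|^{2β} dξ. -/

import Mathlib

open MeasureTheory Real Set Filter Metric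
open scoped FourierTransform ENNReal NNReal Topology

noncomputable section

/-- The tent function `φ_k`, equal to `1` on `[2^k, 2^{k+1}]`, linear on
`[2^{k-1}, 2^k]` and `[2^{k+1}, 3·2^k]`, and `0` elsewhere. -/
def tent (k : ℤ) (x : ℝ) : ℝ :=
  if x ∈ Icc ((2 : ℝ) ^ k) ((2 : ℝ) ^ (k + 1)) then 1
  else if x ∈ Icc ((2 : ℝ) ^ (k - 1)) ((2 : ℝ) ^ k) then (2 : ℝ) ^ (1 - k) * x - 1
  else if x ∈ Icc ((2 : ℝ) ^ (k + 1)) (3 * (2 : ℝ) ^ k) then 3 - (2 : ℝ) ^ (-k) * x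
  else 0

/-- The set `I_n = [-2^{n+1}, -2^n] ∪ [2^n, 2^{n+1}]`. -/
def Iset (n : ℤ) : Set ℝ :=
  Icc (-(2 : ℝ) ^ (n + 1)) (-(2 : ℝ) ^ n) ∪ Icc ((2 : ℝ) ^ n) ((2 : ℝ) ^ (n + 1))

/-- Convolution on `ℝ`. -/
def convF (f g : ℝ → ℂ) (ξ : ℝ) : ℂ := ∫ η : ℝ, f (ξ - η) * g η

lemma zpow_facts (k : ℤ) : (2:ℝ)^(k-1) = 2^k/2 ∧ (2:ℝ)^(k+1) = 2*2^k ∧ (2:ℝ)^(1-k) = 2/2^k ∧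
    (2:ℝ)^(-k) = 1/2^k := by
  refine ⟨?_, ?_, ?_, ?_⟩
  · rw [zpow_sub₀ (by norm_num)]; simp
  · rw [zpow_add₀ (by norm_num)]; simp [mul_comm]
  · rw [zpow_sub₀ (by norm_num)]; simp
  · rw [zpow_neg]; simp

/-- hinge function -/
def hinge (c x : ℝ) : ℝ := max (x - c) 0

lemma tent_hinge (k : ℤ) (x : ℝ) : tent k x =
    2/2^k * (hinge (2^k/2) x - hinge (2^k) x)
      - 1/2^k * (hinge (2*2^k) x - hinge (3*2^k) x) := by
  obtain ⟨h1, h2, h3, h4⟩ := zpow_facts k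
  unfold tent
  rw [h1, h2, h3, h4]
  have hp : (0:ℝ) < 2^k := by positivity
  generalize (2:ℝ)^k = p at *
  unfold hinge
  simp only [mem_Icc]
  rcases le_total x (p/2) with a | a
  · rw [max_eq_right (by linarith), max_eq_right (by linarith), max_eq_right (by linarith),
      max_eq_right (by linarith), if_neg (fun h => by linarith [h.1]),
      if_neg (c := 2 * p ≤ x ∧ _) (fun h => by linarith [h.1])]
    split_ifs with h
    · have : x = p/2 := le_antisymm a h.1
      subst this; field_simp; ring
    · ring
  rcases lt_or_ge x p with b | b
  · rw [max_eq_left (by linarith), max_eq_right (by linarith), max_eq_right (by linarith),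
      max_eq_right (by linarith), if_neg (fun h => by linarith [h.1]), if_pos ⟨a, b.le⟩]
    field_simp; ring
  rcases le_or_gt x (2*p) with c | c
  · rw [max_eq_left (by linarith), max_eq_left (by linarith), max_eq_right (by linarith),
      max_eq_right (by linarith), if_pos ⟨b, c⟩]
    field_simp; ring
  rcases le_or_gt x (3*p) with d | d
  · rw [max_eq_left (by linarith), max_eq_left (by linarith), max_eq_left (by linarith),
      max_eq_right (by linarith), if_neg (fun h => by linarith [h.2]),
      if_neg (fun h => by linarith [h.2]), if_pos ⟨c.le, d⟩]
    field_simp; ring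
  · rw [max_eq_left (by linarith), max_eq_left (by linarith), max_eq_left (by linarith),
      max_eq_left (by linarith), if_neg (fun h => by linarith [h.2]),
      if_neg (fun h => by linarith [h.2]), if_neg (fun h => by linarith [h.2])]
    field_simp; ring

lemma tent_cont (k : ℤ) : Continuous (tent k) := by
  have : tent k = fun x => 2/2^k * (hinge (2^k/2) x - hinge (2^k) x)
      - 1/2^k * (hinge (2*2^k) x - hinge (3*2^k) x) := funext (tent_hinge k)
  rw [this]; unfold hinge; fun_prop

lemma tent_bound (k : ℤ) (x : ℝ) : |tent k x| ≤ (Icc (0:ℝ) (3*2^k)).indicator 1 x := by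
  have hp : (0:ℝ) < 2^k := by positivity
  obtain ⟨h1, h2, h3, h4⟩ := zpow_facts k
  unfold tent
  rw [h1, h2, h3, h4]
  generalize (2:ℝ)^k = p at *
  simp only [mem_Icc]
  split_ifs with a b c
  · rw [indicator_of_mem (show x ∈ Icc 0 (3*p) from ⟨by linarith, by linarith⟩)]; simp
  · rw [indicator_of_mem (show x ∈ Icc 0 (3*p) from ⟨by linarith, by linarith⟩)]
    have : 2/p*x = 2*x/p := by ring
    rw [this, abs_le, Pi.one_apply]
    have h : 1 ≤ 2*x/p := by rw [le_div_iff₀ hp]; linarith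
    have h' : 2*x/p ≤ 2 := by rw [div_le_iff₀ hp]; linarith
    constructor <;> linarith
  · rw [indicator_of_mem (show x ∈ Icc 0 (3*p) from ⟨by linarith, by linarith⟩)]
    have : 1/p*x = x/p := by ring
    rw [this, abs_le, Pi.one_apply]
    have h : 2 ≤ x/p := by rw [le_div_iff₀ hp]; linarith
    have h' : x/p ≤ 3 := by rw [div_le_iff₀ hp]; linarith
    constructor <;> linarith
  · simp only [abs_zero]; exact indicator_nonneg (fun _ _ => zero_le_one) _

lemma tent_int (k : ℤ) : Integrable (tent k) := by
  refine Integrable.mono' (g := (Icc (0:ℝ) (3*2^k)).indicator 1) ?_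
    (tent_cont k).aestronglyMeasurable (Eventually.of_forall (tent_bound k))
  rw [integrable_indicator_iff measurableSet_Icc]
  exact integrableOn_const measure_Icc_lt_top.ne

lemma hinge_dd (c x h : ℝ) (hh : 0 ≤ h) :
    |hinge c (x + h) + hinge c (x - h) - 2 * hinge c x| ≤ (Icc (c-h) (c+h)).indicator (fun _ => h) x := by
  unfold hinge
  by_cases hx : x ∈ Icc (c-h) (c+h)
  · rw [indicator_of_mem hx]
    obtain ⟨a, b⟩ := hx
    rw [max_eq_left (by linarith : 0 ≤ x + h - c), max_eq_right (by linarith : x - h - c ≤ 0)]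
    rcases le_total (x - c) 0 with h' | h'
    · rw [max_eq_right h', abs_le]; constructor <;> linarith
    · rw [max_eq_left h', abs_le]; constructor <;> linarith
  · rw [indicator_of_notMem hx]
    simp only [mem_Icc, not_and_or, not_le] at hx
    rcases hx with hx | hx
    · rw [max_eq_right (by linarith), max_eq_right (by linarith), max_eq_right (by linarith)]; simp
    · rw [max_eq_left (by linarith), max_eq_left (by linarith), max_eq_left (by linarith)]
      apply le_of_eq; rw [abs_eq_zero]; ring

lemma int_ind (c h : ℝ) : Integrable ((Icc (c-h) (c+h)).indicator (fun _ => h)) := by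
  rw [integrable_indicator_iff measurableSet_Icc]
  exact integrableOn_const (by simp)

lemma integral_ind (c h : ℝ) (hh : 0 ≤ h) :
    ∫ x, (Icc (c-h) (c+h)).indicator (fun _ => h) x = 2*h*h := by
  rw [integral_indicator measurableSet_Icc]
  simp only [integral_const, MeasurableSet.univ, measureReal_restrict_apply, univ_inter,
    Real.volume_real_Icc, smul_eq_mul]
  rw [max_eq_left (by linarith)]; ring

lemma tent_dd (k : ℤ) (h : ℝ) (hh : 0 ≤ h) :
    ∫ x, |tent k (x+h) + tent k (x-h) - 2 * tent k x| ≤ 12 * h^2 / 2^k := by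
  have hp : (0:ℝ) < 2^k := by positivity
  set G : ℝ → ℝ → ℝ := fun c => (Icc (c-h) (c+h)).indicator (fun _ => h) with hG
  have key : ∀ x, |tent k (x+h) + tent k (x-h) - 2 * tent k x| ≤
      2/2^k * G (2^k/2) x + 2/2^k * G (2^k) x + 1/2^k * G (2*2^k) x + 1/2^k * G (3*2^k) x := by
    intro x
    simp only [tent_hinge]
    have A : ∀ c, |hinge c (x + h) + hinge c (x - h) - 2 * hinge c x| ≤ G c x :=
      fun c => hinge_dd c x h hh
    have e1 := A (2^k/2)
    have e2 := A (2^k)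
    have e3 := A (2*2^k)
    have e4 := A (3*2^k)
    generalize (2:ℝ)^k = p at *
    have hq : 0 < 1/p := by positivity
    have : 2/p = 2*(1/p) := by ring
    rw [this]
    generalize 1/p = q at *
    rw [abs_le] at *
    constructor
    · nlinarith
    · nlinarith
  have iG : ∀ c, Integrable (G c) := fun c => int_ind c h
  calc _ ≤ ∫ x, (2/2^k * G (2^k/2) x + 2/2^k * G (2^k) x + 1/2^k * G (2*2^k) x + 1/2^k * G (3*2^k) x) := by
        refine integral_mono ?_ ?_ key
        · exact (((tent_int k).comp_add_right h).add ((tent_int k).comp_sub_right h)).sub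
            ((tent_int k).const_mul 2) |>.abs
        · exact ((((iG _).const_mul _).add ((iG _).const_mul _)).add ((iG _).const_mul _)).add
            ((iG _).const_mul _)
    _ = _ := by
        rw [integral_add, integral_add, integral_add]
        · simp only [integral_const_mul, hG, integral_ind _ h hh]
          field_simp; ring
        · exact (iG _).const_mul _
        · exact (iG _).const_mul _
        · exact ((iG _).const_mul _).add ((iG _).const_mul _)
        · exact (iG _).const_mul _
        · exact (((iG _).const_mul _).add ((iG _).const_mul _)).add ((iG _).const_mul _)
        · exact (iG _).const_mul _

lemma inv_eq (f : ℝ → ℝ) (x : ℝ) : 𝓕⁻ (fun x => (f x : ℂ)) x =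
    ∫ v : ℝ, Complex.exp ((2 * π * (v * x) : ℝ) * Complex.I) * f v := by
  rw [Real.fourierInv_eq']
  congr 1; ext v
  simp [mul_comm]

lemma inv_bound0 (k : ℤ) (x : ℝ) : ‖𝓕⁻ (fun x => (tent k x : ℂ)) x‖ ≤ 3 * 2^k := by
  rw [inv_eq]
  refine (norm_integral_le_integral_norm _).trans ?_
  simp only [norm_mul, Complex.norm_exp_ofReal_mul_I, one_mul, Complex.norm_real, Real.norm_eq_abs]
  calc _ ≤ ∫ v, (Icc (0:ℝ) (3*2^k)).indicator 1 v := by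
        refine integral_mono (tent_int k).abs ?_ (tent_bound k)
        rw [integrable_indicator_iff measurableSet_Icc]
        exact integrableOn_const measure_Icc_lt_top.ne
    _ = _ := by
        rw [integral_indicator measurableSet_Icc]
        have : (0:ℝ) ≤ 2^k := by positivity
        simp [this]

lemma exp_int (x : ℝ) (f : ℝ → ℝ) (hf : Integrable f) :
    Integrable (fun v : ℝ => Complex.exp ((2 * π * (v * x) : ℝ) * Complex.I) * f v) := by
  refine (hf.ofReal (𝕜 := ℂ)).bdd_mul (c := 1) ?_ ?_
  · apply Continuous.aestronglyMeasurable; fun_prop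
  · exact Eventually.of_forall fun v => by rw [Complex.norm_exp_ofReal_mul_I]

lemma inv_shift (f : ℝ → ℝ) (x h : ℝ) (hh : 2 * (h * x) = 1 ∨ 2 * (h * x) = -1) :
    ∫ v : ℝ, Complex.exp ((2 * π * (v * x) : ℝ) * Complex.I) * f (v + h) =
    - ∫ v : ℝ, Complex.exp ((2 * π * (v * x) : ℝ) * Complex.I) * f v := by
  rw [← integral_add_right_eq_self (fun v : ℝ => Complex.exp ((2 * π * (v * x) : ℝ) * Complex.I) * f v) h,
    ← integral_neg]
  congr 1; ext v
  have : Complex.exp ((2 * π * ((v+h) * x) : ℝ) * Complex.I) =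
      - Complex.exp ((2 * π * (v * x) : ℝ) * Complex.I) := by
    have e : ((2 * π * ((v+h) * x) : ℝ) : ℂ) * Complex.I =
       (2 * π * (v * x) : ℝ) * Complex.I + (π * (2 * (h * x)) : ℝ) * Complex.I := by
      push_cast; ring
    rw [e, Complex.exp_add]
    rcases hh with hh | hh
    · rw [hh]; simp [Complex.exp_pi_mul_I]
    · rw [hh]; simp [Complex.exp_neg, Complex.exp_pi_mul_I]
  rw [this]; ring

lemma inv_bound1 (k : ℤ) (x : ℝ) (hx : x ≠ 0) :
    ‖𝓕⁻ (fun x => (tent k x : ℂ)) x‖ ≤ 3 / (2^k * x^2) := by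
  have hp : (0:ℝ) < 2^k := by positivity
  set h := 1 / (2 * |x|) with hh
  have hx' : 0 < |x| := abs_pos.mpr hx
  have h0 : 0 ≤ h := by positivity
  have hs : 2 * (h * x) = 1 ∨ 2 * (h * x) = -1 := by
    rcases le_total 0 x with a | a
    · left; rw [hh, abs_of_nonneg a]; field_simp
    · right; rw [hh, abs_of_nonpos a]; field_simp
  have hs' : 2 * ((-h) * x) = 1 ∨ 2 * ((-h) * x) = -1 := by
    rcases hs with a | a
    · right; linarith
    · left; linarith
  have e1 := inv_shift (tent k) x h hs
  have e2 := inv_shift (tent k) x (-h) hs'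
  have i0 := exp_int x _ (tent_int k)
  have i1 := exp_int x _ ((tent_int k).comp_add_right h)
  have i2 := exp_int x _ ((tent_int k).comp_add_right (-h))
  have e3 : -4 * 𝓕⁻ (fun x => (tent k x : ℂ)) x = ∫ v : ℝ,
      Complex.exp ((2 * π * (v * x) : ℝ) * Complex.I) *
        ((tent k (v+h) + tent k (v-h) - 2 * tent k v : ℝ) : ℂ) := by
    have : ∀ v : ℝ, Complex.exp ((2 * π * (v * x) : ℝ) * Complex.I) *
        ((tent k (v+h) + tent k (v-h) - 2 * tent k v : ℝ) : ℂ) =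
        (Complex.exp ((2 * π * (v * x) : ℝ) * Complex.I) * tent k (v+h) +
        Complex.exp ((2 * π * (v * x) : ℝ) * Complex.I) * tent k (v+(-h))) -
        2 * (Complex.exp ((2 * π * (v * x) : ℝ) * Complex.I) * tent k v) := by
      intro v; push_cast; rw [← sub_eq_add_neg]; ring
    simp_rw [this]
    rw [integral_sub (by exact i1.add i2) (i0.const_mul 2), integral_add i1 i2, e1, e2, integral_const_mul, inv_eq]
    ring
  have e4 : 4 * ‖𝓕⁻ (fun x => (tent k x : ℂ)) x‖ ≤ 12 * h^2 / 2^k := by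
    have : 4 * ‖𝓕⁻ (fun x => (tent k x : ℂ)) x‖ = ‖-4 * 𝓕⁻ (fun x => (tent k x : ℂ)) x‖ := by
      rw [norm_mul]; norm_num
    rw [this, e3]
    refine (norm_integral_le_integral_norm _).trans ?_
    simp only [norm_mul, Complex.norm_exp_ofReal_mul_I, one_mul, Complex.norm_real, Real.norm_eq_abs]
    exact tent_dd k h h0
  have e5 : 12 * h^2 / 2^k = 3 / (2^k * x^2) := by
    rw [hh, div_pow, mul_pow, sq_abs]; field_simp; norm_num
  have : 0 ≤ ‖𝓕⁻ (fun x => (tent k x : ℂ)) x‖ := norm_nonneg _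
  linarith

/-- the profile -/
def psi (k : ℤ) (r : ℝ) : ℝ := min (2^k * r) (1 / (2^k * r))

lemma Iset_abs {n : ℤ} {x : ℝ} (hx : x ∈ Iset n) : (2:ℝ)^n ≤ |x| ∧ |x| ≤ 2^(n+1) := by
  have hp : (0:ℝ) < 2^n := by positivity
  rcases hx with ⟨a, b⟩ | ⟨a, b⟩
  · rw [abs_of_nonpos (by linarith)]; constructor <;> linarith
  · rw [abs_of_nonneg (by linarith)]; exact ⟨a, b⟩

lemma sep_aux {m n : ℤ} {x y : ℝ} (hx : x ∈ Iset m) (hy : y ∈ Iset n) (h : m + 2 ≤ n) :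
    2 * |x| ≤ |y| := by
  have a := (Iset_abs hx).2
  have b := (Iset_abs hy).1
  have c : (2:ℝ)^(m+2) ≤ 2^n := zpow_le_zpow_right₀ (by norm_num) h
  have d : (2:ℝ)^(m+2) = 2 * 2^(m+1) := by
    rw [show m + 2 = (m+1)+1 by ring, (zpow_facts (m+1)).2.1]
  linarith

lemma sep {m n : ℤ} {x y : ℝ} (hx : x ∈ Iset m) (hy : y ∈ Iset n) (h : 2 ≤ |n - m|) :
    max |x| |y| ≤ 2 * |x - y| := by
  have t1 := abs_sub_abs_le_abs_sub x y
  have t2 := abs_sub_abs_le_abs_sub y x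
  rw [abs_sub_comm y x] at t2
  rcases le_abs.mp h with h | h
  · have := sep_aux hx hy (by linarith)
    apply max_le <;> linarith [abs_nonneg x, abs_nonneg y]
  · have := sep_aux hy hx (by linarith)
    apply max_le <;> linarith [abs_nonneg x, abs_nonneg y]

lemma Iset_ne {n : ℤ} {x : ℝ} (hx : x ∈ Iset n) : x ≠ 0 := by
  have := (Iset_abs hx).1
  have hp : (0:ℝ) < 2^n := by positivity
  exact abs_pos.mp (by linarith)

lemma kernel_bound {m n : ℤ} {x y : ℝ} (hx : x ∈ Iset m) (hy : y ∈ Iset n) (h : 2 ≤ |n - m|)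
    (k : ℤ) : ‖𝓕⁻ (fun x => (tent k x : ℂ)) (x - y)‖ ≤ 12 * psi k (max |x| |y|) / max |x| |y| := by
  have hs := sep hx hy h
  have hM : 0 < max |x| |y| := lt_max_of_lt_left (abs_pos.mpr (Iset_ne hx))
  generalize max |x| |y| = M at *
  have hp : (0:ℝ) < 2^k := by positivity
  have hd : x - y ≠ 0 := abs_pos.mp (by linarith)
  have b0 := inv_bound0 k (x - y)
  have b1 := inv_bound1 k (x - y) hd
  generalize ‖𝓕⁻ (fun x => (tent k x : ℂ)) (x - y)‖ = F at *
  have b2 : F ≤ 12 / (2^k * M^2) := by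
    refine b1.trans ?_
    rw [div_le_div_iff₀ (by positivity) (by positivity)]
    have : M^2 ≤ 4 * (x-y)^2 := by
      rw [← sq_abs (x - y)]; nlinarith
    nlinarith
  rw [le_div_iff₀ hM, psi, mul_min_of_nonneg _ _ (by norm_num)]
  apply le_min
  · nlinarith
  · calc F * M ≤ 12 / (2^k * M^2) * M := by gcongr
      _ = _ := by field_simp

lemma psi_bound (r : ℝ) (hr : 0 < r) : ∃ j : ℤ, ∀ k, psi k r ^ 2 ≤ 4 * (1/2)^(k + j).natAbs := by
  obtain ⟨j, h1, h2⟩ := exists_mem_Ico_zpow hr (by norm_num : (1:ℝ) < 2)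
  refine ⟨j, fun k => ?_⟩
  have hp : (0:ℝ) < 2^k := by positivity
  have hj : (0:ℝ) < 2^j := by positivity
  rw [(zpow_facts j).2.1] at h2
  have hpsi : 0 ≤ psi k r := by unfold psi; positivity
  have hq : psi k r ≤ 2 * (1/2)^(k+j).natAbs := by
    rcases le_total 0 (k+j) with h | h
    · obtain ⟨n, hn⟩ := Int.eq_ofNat_of_zero_le h
      have e : (2:ℝ)^k * 2^j = 2^n := by
        rw [← zpow_add₀ (by norm_num), hn]; simp
      rw [hn]; simp only [Int.natAbs_natCast]
      refine (min_le_right _ _).trans ?_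
      have : (2:ℝ)^n ≤ 2^k * r := by rw [← e]; gcongr
      calc _ ≤ 1/(2:ℝ)^n := by gcongr
        _ ≤ _ := by rw [one_div_pow]; have : 0 < 1/(2:ℝ)^n := by positivity
                    linarith
    · obtain ⟨n, hn⟩ := Int.eq_ofNat_of_zero_le (neg_nonneg.mpr h)
      have e : (2:ℝ)^k * 2^j = (1/2)^n := by
        rw [← zpow_add₀ (by norm_num), show k + j = -(n:ℤ) by linarith]; simp
      rw [show k + j = -(n:ℤ) by linarith]; simp only [Int.natAbs_neg, Int.natAbs_natCast]
      refine (min_le_left _ _).trans ?_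
      rw [← e]; nlinarith
  have h1 : ((1:ℝ)/2)^(k+j).natAbs ≤ 1 := pow_le_one₀ (by norm_num) (by norm_num)
  have h2 : 0 ≤ ((1:ℝ)/2)^(k+j).natAbs := by positivity
  nlinarith

/-- the constant -/
def SS : ℝ≥0∞ := ∑' k : ℤ, ENNReal.ofReal (4 * (1/2)^(k.natAbs))

lemma SS_ne : SS ≠ ⊤ := by
  apply Summable.tsum_ofReal_ne_top
  apply Summable.mul_left
  apply Summable.of_nat_of_neg
  · simpa using summable_geometric_two
  · simpa using summable_geometric_two

lemma psi_sum (r : ℝ) (hr : 0 < r) : ∑' k : ℤ, ENNReal.ofReal (psi k r ^ 2) ≤ SS := by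
  obtain ⟨j, hj⟩ := psi_bound r hr
  calc _ ≤ ∑' k : ℤ, ENNReal.ofReal (4 * (1/2)^((k+j).natAbs)) :=
        ENNReal.tsum_le_tsum fun k => ENNReal.ofReal_le_ofReal (hj k)
    _ = _ := (Equiv.addRight j).tsum_eq (fun k : ℤ => ENNReal.ofReal (4 * (1/2)^(k.natAbs)))

lemma Iset_meas (n : ℤ) : MeasurableSet (Iset n) := measurableSet_Icc.union measurableSet_Icc

lemma Iset_inter {m n : ℤ} (h : m < n) : volume (Iset m ∩ Iset n) = 0 := by
  refine measure_mono_null (t := {2^n, -2^n}) ?_ (Set.Countable.measure_zero (by simp) _)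
  rintro x ⟨h1, h2⟩
  have a := (Iset_abs h1).2
  have b := (Iset_abs h2).1
  have c : (2:ℝ)^(m+1) ≤ 2^n := zpow_le_zpow_right₀ (by norm_num) (by linarith)
  have : |x| = 2^n := le_antisymm (a.trans c) b
  rcases abs_choice x with h | h <;> rw [h] at this
  · left; exact this
  · right; rw [mem_singleton_iff]; linarith

lemma Iset_sum (F : ℝ → ℝ≥0∞) : ∑' n : ℤ, ∫⁻ x in Iset n, F x ≤ ∫⁻ x, F x := by
  rw [← lintegral_iUnion₀ (fun n => (Iset_meas n).nullMeasurableSet)]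
  · exact setLIntegral_le_lintegral _ _
  · intro m n hmn
    rcases lt_or_gt_of_ne hmn with h | h
    · exact Iset_inter h
    · show volume _ = 0
      rw [inter_comm]; exact Iset_inter h

lemma conv_bound (g : ℝ → ℂ) (m k : ℤ) {x : ℝ} (hx : x ∈ Iset m) :
    (‖∑' n : {n : ℤ // 2 ≤ |n - m|},
      convF (𝓕⁻ (fun x => (tent k x : ℂ))) ((Iset (n : ℤ)).indicator g) x‖₊ : ℝ≥0∞) ≤
    ∫⁻ y, ENNReal.ofReal (12 * psi k (max |x| |y|) / max |x| |y|) * ‖g y‖₊ := by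
  rw [← enorm_eq_nnnorm]
  refine enorm_tsum_le_tsum_enorm.trans ?_
  calc _ ≤ ∑' n : {n : ℤ // 2 ≤ |n - m|}, ∫⁻ y in Iset n,
        ENNReal.ofReal (12 * psi k (max |x| |y|) / max |x| |y|) * ‖g y‖₊ := by
        refine ENNReal.tsum_le_tsum fun n => ?_
        unfold convF
        refine (enorm_integral_le_lintegral_enorm _).trans ?_
        rw [← lintegral_indicator (Iset_meas _)]
        refine lintegral_mono fun y => ?_
        by_cases hy : y ∈ Iset n
        · simp only [indicator_of_mem hy, enorm_mul]
          have := ENNReal.ofReal_le_ofReal (kernel_bound hx hy n.2 k)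
          rw [ofReal_norm] at this
          exact mul_le_mul_left this _
        · simp [indicator_of_notMem hy]
    _ ≤ ∑' n : ℤ, ∫⁻ y in Iset n,
        ENNReal.ofReal (12 * psi k (max |x| |y|) / max |x| |y|) * ‖g y‖₊ :=
        ENNReal.tsum_comp_le_tsum_of_injective (f := fun n : {n : ℤ // 2 ≤ |n - m|} => (n:ℤ))
          Subtype.val_injective (fun n : ℤ => ∫⁻ y in Iset n,
        ENNReal.ofReal (12 * psi k (max |x| |y|) / max |x| |y|) * ‖g y‖₊)
    _ ≤ _ := Iset_sum _

lemma even_lint (f : ℝ → ℝ≥0∞) :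
    ∫⁻ y : ℝ, f |y| = 2 * ∫⁻ y in Ioi (0:ℝ), f y := by
  have h1 : ∫⁻ y in Ioi (0:ℝ), f |y| = ∫⁻ y in Ioi (0:ℝ), f y :=
    setLIntegral_congr_fun measurableSet_Ioi fun y hy => by simp only [abs_of_pos (mem_Ioi.mp hy)]
  have h2 : ∫⁻ y in Iic (0:ℝ), f |y| = ∫⁻ y in Ioi (0:ℝ), f y := by
    have := (Measure.measurePreserving_neg (volume : Measure ℝ)).setLIntegral_comp_preimage_emb
      (MeasurableEquiv.neg ℝ).measurableEmbedding (fun y => f |y|) (Ioi 0)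
    rw [← h1, ← this, ← Measure.restrict_congr_set (Iio_ae_eq_Iic)]
    simp
  rw [← lintegral_add_compl _ (measurableSet_Ioi (a := (0:ℝ))), compl_Ioi, h1, h2, two_mul]

lemma hardy (a : ℝ) (h0 : 0 < a) (h1 : a < 1) (x : ℝ) (hx : x ≠ 0) :
    ∫⁻ y : ℝ, ENNReal.ofReal (|y| ^ (-a) / max |x| |y|) ≤
      ENNReal.ofReal (2 * (1/(1-a) + 1/a)) * ENNReal.ofReal (|x| ^ (-a)) := by
  have hc : 0 < |x| := abs_pos.mpr hx
  generalize |x| = c at *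
  rw [even_lint (fun r => ENNReal.ofReal (r ^ (-a) / max c r)), ← Ioc_union_Ioi_eq_Ioi hc.le]
  have e1 : ∫⁻ y in Ioc 0 c, ENNReal.ofReal (y ^ (-a) / max c y) = ENNReal.ofReal (c^(-a)/(1-a)) := by
    have : ∫⁻ y in Ioc 0 c, ENNReal.ofReal (y ^ (-a) / max c y) =
        ∫⁻ y in Ioc 0 c, ENNReal.ofReal (y ^ (-a) / c) :=
      setLIntegral_congr_fun measurableSet_Ioc fun y hy => by simp only [max_eq_left hy.2]
    rw [this, ← ofReal_integral_eq_lintegral_ofReal]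
    · rw [integral_div, ← intervalIntegral.integral_of_le hc.le, integral_rpow (Or.inl (by linarith)),
        Real.zero_rpow (by linarith), Real.rpow_add hc, Real.rpow_one]
      congr 1
      have : 1 - a ≠ 0 := by linarith
      have : -a + 1 ≠ 0 := by linarith
      field_simp; ring
    · apply Integrable.div_const
      exact (intervalIntegrable_iff_integrableOn_Ioc_of_le hc.le).mp
        (intervalIntegral.intervalIntegrable_rpow' (by linarith))
    · filter_upwards [ae_restrict_mem measurableSet_Ioc] with y hy
      have := hy.1
      simp only [Pi.zero_apply]; positivity
  have e2 : ∫⁻ y in Ioi c, ENNReal.ofReal (y ^ (-a) / max c y) = ENNReal.ofReal (c^(-a)/a) := by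
    have : ∫⁻ y in Ioi c, ENNReal.ofReal (y ^ (-a) / max c y) =
        ∫⁻ y in Ioi c, ENNReal.ofReal (y ^ (-a-1)) :=
      setLIntegral_congr_fun measurableSet_Ioi fun y hy => by
        have hy' : c < y := hy
        simp only [max_eq_right hy'.le]
        rw [Real.rpow_sub_one (by linarith)]
    rw [this, ← ofReal_integral_eq_lintegral_ofReal]
    · rw [integral_Ioi_rpow_of_lt (by linarith) hc]
      congr 1
      simp only [sub_add_cancel]
      field_simp
    · exact integrableOn_Ioi_rpow_of_lt (by linarith) hc
    · filter_upwards [ae_restrict_mem measurableSet_Ioi] with y hy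
      have : 0 < y := hc.trans hy
      simp only [Pi.zero_apply]; positivity
  have h1a : 0 < 1 - a := by linarith
  rw [lintegral_union measurableSet_Ioi (Ioc_disjoint_Ioi le_rfl), e1, e2,
    ← ENNReal.ofReal_add (by positivity) (by positivity), ← ENNReal.ofReal_mul (by positivity),
    show (2:ℝ≥0∞) = ENNReal.ofReal 2 by simp, ← ENNReal.ofReal_mul (by positivity)]
  apply le_of_eq; congr 1; ring

lemma CS (f h : ℝ → ℝ≥0∞) (hf : Measurable f) (hh : Measurable h) :
    (∫⁻ y, f y * h y)^2 ≤ (∫⁻ y, f y ^ 2) * ∫⁻ y, h y ^ 2 := by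
  have := ENNReal.lintegral_mul_le_Lp_mul_Lq volume Real.HolderConjugate.two_two
    hf.aemeasurable hh.aemeasurable
  simp only [Pi.mul_apply, ENNReal.rpow_two] at this
  refine (pow_le_pow_left' this 2).trans (le_of_eq ?_)
  rw [mul_pow, ← ENNReal.rpow_two, ← ENNReal.rpow_two, ← ENNReal.rpow_mul, ← ENNReal.rpow_mul]
  norm_num

lemma psi_meas (k : ℤ) : Measurable (psi k) := by unfold psi; fun_prop

lemma psi_nonneg (k : ℤ) {r : ℝ} (hr : 0 ≤ r) : 0 ≤ psi k r := by unfold psi; positivity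

lemma H_bound (a : ℝ) (g : ℝ → ℂ) (hg : Measurable g) (k : ℤ) (x : ℝ) (hx : x ≠ 0) :
    (∫⁻ y, ENNReal.ofReal (12 * psi k (max |x| |y|) / max |x| |y|) * ‖g y‖₊)^2 ≤
    (∫⁻ y : ℝ, ENNReal.ofReal (|y| ^ (-a) / max |x| |y|)) *
      ∫⁻ y : ℝ, ENNReal.ofReal (psi k (max |x| |y|) ^ 2) *
        (ENNReal.ofReal (144 * (|y| ^ a / max |x| |y|)) * (‖g y‖₊ : ℝ≥0∞) ^ 2) := by
  have hpm := psi_meas k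
  have hM : ∀ y, 0 < max |x| |y| := fun y => lt_max_of_lt_left (abs_pos.mpr hx)
  have key := CS (fun y => ENNReal.ofReal (√(|y| ^ (-a) / max |x| |y|)))
    (fun y => ENNReal.ofReal (12 * psi k (max |x| |y|) * √(|y| ^ a / max |x| |y|)) * ‖g y‖₊)
    (by fun_prop) (by fun_prop)
  have e1 : (∫⁻ y, ENNReal.ofReal (12 * psi k (max |x| |y|) / max |x| |y|) * ‖g y‖₊) =
      ∫⁻ y, ENNReal.ofReal (√(|y| ^ (-a) / max |x| |y|)) *
        (ENNReal.ofReal (12 * psi k (max |x| |y|) * √(|y| ^ a / max |x| |y|)) * ‖g y‖₊) := by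
    refine lintegral_congr_ae ?_
    filter_upwards [Measure.ae_ne volume (0:ℝ)] with y hy
    have hy' : 0 < |y| := abs_pos.mpr hy
    rw [← mul_assoc, ← ENNReal.ofReal_mul (by positivity)]
    congr 2
    have : √(|y| ^ (-a) / max |x| |y|) * √(|y| ^ a / max |x| |y|) = 1 / max |x| |y| := by
      rw [← Real.sqrt_mul (div_nonneg (by positivity) (hM y).le), div_mul_div_comm,
        ← Real.rpow_add hy', neg_add_cancel, Real.rpow_zero, ← one_div_mul_one_div,
        Real.sqrt_mul_self (one_div_nonneg.mpr (hM y).le)]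
    calc _ = 12 * psi k (max |x| |y|) * (1 / max |x| |y|) := by ring
      _ = _ := by rw [← this]; ring
  rw [e1]
  refine key.trans (le_of_eq ?_)
  congr 1
  · refine lintegral_congr fun y => ?_
    have := hM y
    rw [← ENNReal.ofReal_pow (by positivity), Real.sq_sqrt (by positivity)]
  · refine lintegral_congr fun y => ?_
    have := hM y
    have h2 := psi_nonneg k this.le
    rw [mul_pow, ← ENNReal.ofReal_pow (by positivity), mul_pow, Real.sq_sqrt (by positivity),
      ← mul_assoc, ← ENNReal.ofReal_mul (by positivity)]
    congr 2; ring

lemma H_sum (a : ℝ) (h0 : 0 < a) (h1 : a < 1) (g : ℝ → ℂ) (hg : Measurable g) (x : ℝ) (hx : x ≠ 0) :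
    ∑' k : ℤ, (∫⁻ y, ENNReal.ofReal (12 * psi k (max |x| |y|) / max |x| |y|) * ‖g y‖₊)^2 ≤
    (ENNReal.ofReal (2 * (1/(1-a) + 1/a)) * ENNReal.ofReal (|x| ^ (-a))) *
      (SS * ∫⁻ y : ℝ, ENNReal.ofReal (144 * (|y| ^ a / max |x| |y|)) * (‖g y‖₊ : ℝ≥0∞) ^ 2) := by
  have hM : ∀ y, 0 < max |x| |y| := fun y => lt_max_of_lt_left (abs_pos.mpr hx)
  refine (ENNReal.tsum_le_tsum fun k => H_bound a g hg k x hx).trans ?_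
  rw [ENNReal.tsum_mul_left]
  gcongr
  · exact hardy a h0 h1 x hx
  · rw [← lintegral_tsum, ← lintegral_const_mul]
    · refine lintegral_mono fun y => ?_
      rw [ENNReal.tsum_mul_right]
      gcongr
      exact psi_sum _ (hM y)
    · fun_prop
    · intro k
      have hpm := psi_meas k
      fun_prop

/-- The "off-diagonal" part `J₂` of the dyadic-tent decomposition:
`Σ_m Σ_k ∫_{I_m} |Σ_{|n-m|≥2} (φ_k^∨ * g_n)(ξ)|² |ξ|^{2β} dξ ≤ C ∫ |g|² |ξ|^{2β} dξ`. -/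
theorem stmt13 (β : ℝ) (hβ : β ∈ Ioo (-(1 / 2) : ℝ) (1 / 2)) :
    ∃ C : ℝ, ∀ g : ℝ → ℂ, Measurable g →
      (∫⁻ ξ : ℝ, (‖g ξ‖₊ : ℝ≥0∞) ^ 2 * ENNReal.ofReal (|ξ| ^ (2 * β))) < ⊤ →
      ∑' (m : ℤ), ∑' (k : ℤ),
          ∫⁻ ξ in Iset m,
            (‖∑' n : {n : ℤ // 2 ≤ |n - m|},
                convF (𝓕⁻ (fun x => (tent k x : ℂ))) ((Iset (n : ℤ)).indicator g) ξ‖₊ :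
              ℝ≥0∞) ^ 2 *
              ENNReal.ofReal (|ξ| ^ (2 * β))
        ≤ ENNReal.ofReal C *
            ∫⁻ ξ : ℝ, (‖g ξ‖₊ : ℝ≥0∞) ^ 2 * ENNReal.ofReal (|ξ| ^ (2 * β)) := by
  obtain ⟨hb1, hb2⟩ := hβ
  set a := 1/2 + β with ha
  set b := 1/2 - β with hb
  set Da := ENNReal.ofReal (2 * (1/(1-a) + 1/a)) with hDa
  set Db := ENNReal.ofReal (2 * (1/(1-b) + 1/b)) with hDb
  refine ⟨(144 * Da * SS * Db).toReal, fun g hg _ => ?_⟩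
  have hfin : 144 * Da * SS * Db ≠ ⊤ := by
    refine ENNReal.mul_ne_top (ENNReal.mul_ne_top (ENNReal.mul_ne_top (by simp) ?_) SS_ne) ?_
    · exact ENNReal.ofReal_ne_top
    · exact ENNReal.ofReal_ne_top
  rw [ENNReal.ofReal_toReal hfin]
  set H : ℤ → ℝ → ℝ≥0∞ := fun k x =>
    (∫⁻ y, ENNReal.ofReal (12 * psi k (max |x| |y|) / max |x| |y|) * ‖g y‖₊)^2 with hH
  have Hm : ∀ k, Measurable (H k) := by
    intro k
    have hpm := psi_meas k
    refine Measurable.pow_const ?_ 2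
    apply Measurable.lintegral_prod_right'
      (f := fun p : ℝ × ℝ => ENNReal.ofReal (12 * psi k (max |p.1| |p.2|) / max |p.1| |p.2|) * ‖g p.2‖₊)
    fun_prop
  have hconv : ∀ (m k : ℤ) (x : ℝ), x ∈ Iset m →
      (‖∑' n : {n : ℤ // 2 ≤ |n - m|},
        convF (𝓕⁻ (fun x => (tent k x : ℂ))) ((Iset (n : ℤ)).indicator g) x‖₊ : ℝ≥0∞) ^ 2 ≤ H k x :=
    fun m k x hx => pow_le_pow_left' (conv_bound g m k hx) 2
  have hsum : ∀ x : ℝ, x ≠ 0 → ∑' k : ℤ, H k x ≤ (Da * ENNReal.ofReal (|x| ^ (-a))) *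
      (SS * ∫⁻ y : ℝ, ENNReal.ofReal (144 * (|y| ^ a / max |x| |y|)) * (‖g y‖₊ : ℝ≥0∞) ^ 2) :=
    fun x hx => H_sum a (by linarith) (by linarith) g hg x hx
  clear_value H
  calc _ ≤ ∑' (m : ℤ), ∑' (k : ℤ), ∫⁻ ξ in Iset m, H k ξ * ENNReal.ofReal (|ξ| ^ (2 * β)) := by
        refine ENNReal.tsum_le_tsum fun m => ENNReal.tsum_le_tsum fun k => ?_
        refine setLIntegral_mono' (Iset_meas m) fun x hx => ?_
        exact mul_le_mul_left (hconv m k x hx) _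
    _ = ∑' (k : ℤ), ∑' (m : ℤ), ∫⁻ ξ in Iset m, H k ξ * ENNReal.ofReal (|ξ| ^ (2 * β)) :=
        ENNReal.tsum_comm
    _ ≤ ∑' (k : ℤ), ∫⁻ ξ, H k ξ * ENNReal.ofReal (|ξ| ^ (2 * β)) :=
        ENNReal.tsum_le_tsum fun k => Iset_sum _
    _ = ∫⁻ ξ, (∑' (k : ℤ), H k ξ) * ENNReal.ofReal (|ξ| ^ (2 * β)) := by
        rw [← lintegral_tsum]
        · simp_rw [ENNReal.tsum_mul_right]
        · intro k
          exact ((Hm k).mul (by fun_prop)).aemeasurable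
    _ ≤ ∫⁻ x, (144 * Da * SS) * ∫⁻ y, ENNReal.ofReal (|x| ^ (-b) / max |y| |x|) *
          (ENNReal.ofReal (|y| ^ a) * (‖g y‖₊ : ℝ≥0∞) ^ 2) := by
        refine lintegral_mono_ae ?_
        filter_upwards [Measure.ae_ne volume (0:ℝ)] with x hx
        have hx' : 0 < |x| := abs_pos.mpr hx
        refine (mul_le_mul_left (hsum x hx) _).trans (le_of_eq ?_)
        have e : ∀ y, ENNReal.ofReal (144 * (|y| ^ a / max |x| |y|)) * (‖g y‖₊ : ℝ≥0∞) ^ 2 =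
            144 * (ENNReal.ofReal (1 / max |y| |x|) * (ENNReal.ofReal (|y| ^ a) * (‖g y‖₊ : ℝ≥0∞) ^ 2)) := by
          intro y
          rw [← mul_assoc, ← mul_assoc, show (144:ℝ≥0∞) = ENNReal.ofReal 144 by simp,
            ← ENNReal.ofReal_mul (by norm_num), ← ENNReal.ofReal_mul (by positivity), max_comm]
          congr 2; ring
        have e' : ∀ y, ENNReal.ofReal (|x| ^ (-b) / max |y| |x|) *
            (ENNReal.ofReal (|y| ^ a) * (‖g y‖₊ : ℝ≥0∞) ^ 2) =
            ENNReal.ofReal (|x| ^ (-b)) *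
            (ENNReal.ofReal (1 / max |y| |x|) * (ENNReal.ofReal (|y| ^ a) * (‖g y‖₊ : ℝ≥0∞) ^ 2)) := by
          intro y
          rw [← mul_assoc (ENNReal.ofReal (|x| ^ (-b))), ← ENNReal.ofReal_mul (by positivity)]
          congr 2; ring
        simp_rw [e, e']
        rw [lintegral_const_mul _ (by fun_prop), lintegral_const_mul _ (by fun_prop)]
        have e3 : ENNReal.ofReal (|x| ^ (-b)) = ENNReal.ofReal (|x| ^ (-a)) *
            ENNReal.ofReal (|x| ^ (2 * β)) := by
          rw [← ENNReal.ofReal_mul (by positivity), ← Real.rpow_add hx']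
          congr 2; rw [ha, hb]; ring
        rw [e3]; ring
    _ = (144 * Da * SS) * ∫⁻ y, ∫⁻ x, ENNReal.ofReal (|x| ^ (-b) / max |y| |x|) *
          (ENNReal.ofReal (|y| ^ a) * (‖g y‖₊ : ℝ≥0∞) ^ 2) := by
        have hmm : Measurable (fun p : ℝ × ℝ => ENNReal.ofReal (|p.1| ^ (-b) / max |p.2| |p.1|) *
            (ENNReal.ofReal (|p.2| ^ a) * (‖g p.2‖₊ : ℝ≥0∞) ^ 2)) := by fun_prop
        rw [lintegral_const_mul _ hmm.lintegral_prod_right', lintegral_lintegral_swap]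
        exact hmm.aemeasurable
    _ ≤ (144 * Da * SS) * ∫⁻ y, Db * ((‖g y‖₊ : ℝ≥0∞) ^ 2 * ENNReal.ofReal (|y| ^ (2 * β))) := by
        refine mul_le_mul_right (lintegral_mono_ae ?_) _
        filter_upwards [Measure.ae_ne volume (0:ℝ)] with y hy
        have hy' : 0 < |y| := abs_pos.mpr hy
        rw [lintegral_mul_const _ (by fun_prop)]
        refine (mul_le_mul_left (hardy b (by linarith) (by linarith) y hy) _).trans (le_of_eq ?_)
        have e3 : ENNReal.ofReal (|y| ^ (2 * β)) = ENNReal.ofReal (|y| ^ (-b)) *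
            ENNReal.ofReal (|y| ^ a) := by
          rw [← ENNReal.ofReal_mul (by positivity), ← Real.rpow_add hy']
          congr 2; rw [ha, hb]; ring
        rw [e3]; ring
    _ = _ := by
        rw [lintegral_const_mul _ (by fun_prop), ← mul_assoc]
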